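/- Under the standing assumptions, and with E_0 a constant as specified, there exists L_1 > 0 such that for every natural number L > L_1 the following holds: if g, h_1, …, h_m ∈ G (m ≥ 1) are such that the sequences (x_0, h_1Υ_L, …, h_mΥ_L, g x_0), (g^{-1} x_0, h_1Υ_L) and (h_mΥ_L, g^2 x_0) are each (6E_0+360δ)-aligned, then the bi-infinite sequence of geodesics (g^j h_i Υ_L), indexed by pairs (j,i) ∈ ℤ × {1,…,m} in lexicographic order, is (12E_0+900δ)-aligned, i.e., every pair of consecutive entries (g^j h_i Υ_L, g^{j'} h_{i'} Υ_L) in this order is (12E_0+900δ)-aligned. -/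

import Mathlib

namespace AcylCount

/-! ### Geodesic segments and Gromov hyperbolicity -/

/-- A finite geodesic segment in a metric space, parametrized by arclength on `[0, len]`,
oriented from `initial := toFun 0` to `terminal := toFun len`. -/
structure GeodesicSegment (X : Type*) [MetricSpace X] where
  len : ℝ
  len_nonneg : 0 ≤ len
  toFun : ℝ → X
  isom : ∀ s ∈ Set.Icc (0:ℝ) len, ∀ t ∈ Set.Icc (0:ℝ) len,
    dist (toFun s) (toFun t) = |s - t|

namespace GeodesicSegment

variable {X : Type*} [MetricSpace X]

/-- The initial point of a geodesic segment. -/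
def initial (γ : GeodesicSegment X) : X := γ.toFun 0

/-- The terminal point of a geodesic segment. -/
def terminal (γ : GeodesicSegment X) : X := γ.toFun γ.len

/-- The image (underlying set) of a geodesic segment. -/
def seg (γ : GeodesicSegment X) : Set X := γ.toFun '' Set.Icc 0 γ.len

/-- The translate of a geodesic segment by an isometry. -/
def translate (γ : GeodesicSegment X) (f : X → X) (hf : Isometry f) :
    GeodesicSegment X where
  len := γ.len
  len_nonneg := γ.len_nonneg
  toFun := f ∘ γ.toFun
  isom := fun s hs t ht => by
    simp only [Function.comp_apply, hf.dist_eq]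
    exact γ.isom s hs t ht

/-- The degenerate geodesic segment consisting of a single point. -/
def point (p : X) : GeodesicSegment X where
  len := 0
  len_nonneg := le_refl 0
  toFun := fun _ => p
  isom := fun s hs t ht => by
    have hs0 : s = 0 := le_antisymm hs.2 hs.1
    have ht0 : t = 0 := le_antisymm ht.2 ht.1
    simp [hs0, ht0]

/-- `η` is a subsegment of `γ`. -/
def IsSubsegment (η γ : GeodesicSegment X) : Prop :=
  ∃ a b : ℝ, 0 ≤ a ∧ a ≤ b ∧ b ≤ γ.len ∧ η.len = b - a ∧
    ∀ t ∈ Set.Icc (0:ℝ) η.len, η.toFun t = γ.toFun (a + t)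

/-- `p` occurs (weakly) before `q` along the oriented geodesic segment `γ`. -/
def Before (γ : GeodesicSegment X) (p q : X) : Prop :=
  ∃ s t : ℝ, s ∈ Set.Icc (0:ℝ) γ.len ∧ t ∈ Set.Icc (0:ℝ) γ.len ∧ s ≤ t ∧
    γ.toFun s = p ∧ γ.toFun t = q

end GeodesicSegment

/-- A geodesic metric space: every two points are joined by a geodesic segment. -/
def IsGeodesicSpace (X : Type*) [MetricSpace X] : Prop :=
  ∀ x y : X, ∃ γ : GeodesicSegment X, γ.initial = x ∧ γ.terminal = y

/-- δ-hyperbolicity via slim triangles: each side of a geodesic triangle lies in the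
closed δ-neighborhood of the union of the other two sides. -/
def IsDeltaHyperbolic (X : Type*) [MetricSpace X] (δ : ℝ) : Prop :=
  ∀ γ₁ γ₂ γ₃ : GeodesicSegment X,
    γ₁.initial = γ₃.initial → γ₁.terminal = γ₂.initial → γ₂.terminal = γ₃.terminal →
    γ₃.seg ⊆ Metric.cthickening δ (γ₁.seg ∪ γ₂.seg)

variable {X : Type*} [MetricSpace X]

/-- The closest point projection of `x` to (the image of) the geodesic `γ`. -/
def proj (γ : GeodesicSegment X) (x : X) : Set X :=
  {p | p ∈ γ.seg ∧ dist x p = Metric.infDist x γ.seg}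

/-- The closest point projection of a set `A` to the geodesic `γ`. -/
def projSet (γ : GeodesicSegment X) (A : Set X) : Set X :=
  ⋃ a ∈ A, proj γ a

/-- The ordered pair of oriented geodesic segments `(γ, η)` is `K`-aligned. -/
def AlignedPair (K : ℝ) (γ η : GeodesicSegment X) : Prop :=
  Metric.diam (projSet γ η.seg ∪ {γ.terminal}) < K ∧
  Metric.diam (projSet η γ.seg ∪ {η.initial}) < K

/-- A sequence of oriented geodesic segments is `K`-aligned if each consecutive
pair is `K`-aligned. -/
def AlignedSeq (K : ℝ) (l : List (GeodesicSegment X)) : Prop :=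
  l.Chain' (AlignedPair K)

/-- The Gromov product `(y, z)_x`. -/
noncomputable def gromovProd (x y z : X) : ℝ := (dist y x + dist x z - dist y z) / 2

/-! ### Word metric -/

variable {G : Type*} [Group G]

/-- The word length of `g` with respect to the (symmetrized) generating set `S`. -/
noncomputable def wordLength (S : Finset G) (g : G) : ℕ :=
  sInf {n | ∃ l : List G, l.length = n ∧ (∀ x ∈ l, x ∈ S ∨ x⁻¹ ∈ S) ∧ l.prod = g}

/-- The word metric on `G` with respect to `S`. -/
noncomputable def wordDist (S : Finset G) (g h : G) : ℕ := wordLength S (g⁻¹ * h)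

/-- The ball of radius `r` in the word metric, centered at the identity. -/
def ball (S : Finset G) (r : ℝ) : Set G := {g | (wordLength S g : ℝ) ≤ r}

/-- `G` has no cyclic subgroup of finite index. -/
def NonVirtuallyCyclic (G : Type*) [Group G] : Prop :=
  ¬ ∃ H : Subgroup G, H.FiniteIndex ∧ IsCyclic H

/-! ### Isometric actions, loxodromics, WPD -/

/-- `g` is a loxodromic isometry for the action `ρ` with basepoint `x0`: the asymptotic
translation length `τ_X(g) = lim dist x0 (g^n x0) / n` exists and is positive. -/
def IsLoxodromic (ρ : G → X → X) (x0 : X) (g : G) : Prop :=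
  ∃ τ : ℝ, 0 < τ ∧
    Filter.Tendsto (fun n : ℕ => dist x0 (ρ (g ^ n) x0) / n) Filter.atTop (nhds τ)

/-- The WPD (weak proper discontinuity) property of `g` for the action `ρ` with
basepoint `x0`. -/
def HasWPD (ρ : G → X → X) (x0 : X) (g : G) : Prop :=
  ∀ K : ℝ, 0 < K → ∃ N M : ℕ,
    {h : G | dist x0 (ρ h x0) < K ∧ dist (ρ (g ^ N) x0) (ρ h (ρ (g ^ N) x0)) < K}.Finite ∧
    {h : G | dist x0 (ρ h x0) < K ∧ dist (ρ (g ^ N) x0) (ρ h (ρ (g ^ N) x0)) < K}.ncard < M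

/-- The list of translated geodesics `h 1 • Υ, …, h m • Υ`. -/
def transList (ρ : G → X → X) (hisom : ∀ g : G, Isometry (ρ g))
    (Υ : GeodesicSegment X) (h : ℕ → G) (m : ℕ) : List (GeodesicSegment X) :=
  (List.range m).map fun i => Υ.translate (ρ (h (i + 1))) (hisom _)

/-- The specification of the constant `E₀` from Fact 2.7 (Bestvina–Fujiwara):
(i) Gromov product bounds, (ii) the WPD-type conclusion for large projections. -/
def E0Spec (S : Finset G) (ρ : G → X → X) (x0 : X) (φ : G) (E0 : ℝ) : Prop :=
  0 < E0 ∧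
  (∀ g : G, ∃ s t : G, (s ∈ S ∨ s = 1) ∧ (t ∈ S ∨ t = 1) ∧
    (∀ i : ℤ, 0 < i → gromovProd x0 (ρ (φ ^ i) x0) (ρ (s * g) x0) ≤ E0) ∧
    (∀ j : ℤ, j < 0 → gromovProd x0 (ρ (φ ^ j) x0) (ρ (t * g) x0) ≤ E0)) ∧
  (∀ n : ℕ, 0 < n → ∀ g : G, ∀ γ : GeodesicSegment X,
    γ.initial = x0 → γ.terminal = ρ (φ ^ n) x0 →
    ∀ p ∈ proj γ (ρ g x0), ∀ q ∈ proj γ (ρ (g * φ ^ n) x0),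
      γ.Before p q → E0 < dist p q →
      ∃ i j : ℕ, i ≤ n ∧ j ≤ n ∧ (wordDist S (φ ^ i) (g * φ ^ j) : ℝ) < E0)

/-- The set `V_{L,ε}(n)`. Here `Υ` is the chosen geodesic `Υ_L = [x₀, φ^L x₀]`. -/
def Vset (S : Finset G) (ρ : G → X → X) (hisom : ∀ g : G, Isometry (ρ g)) (x0 : X)
    (δ E0 : ℝ) (Υ : GeodesicSegment X) (ε : ℝ) (n : ℕ) : Set G :=
  {g | g ∈ ball S (n:ℝ) ∧ ∃ h : ℕ → G,
    AlignedSeq (6 * E0 + 300 * δ)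
      ([GeodesicSegment.point x0] ++ transList ρ hisom Υ h ⌈ε * (n:ℝ)⌉₊ ++
        [GeodesicSegment.point (ρ g x0)])}

/-- The set `W_{L,ε}(n)`. Here `Υ` is the chosen geodesic `Υ_L = [x₀, φ^L x₀]`. -/
def Wset (S : Finset G) (ρ : G → X → X) (hisom : ∀ g : G, Isometry (ρ g)) (x0 : X)
    (δ E0 : ℝ) (Υ : GeodesicSegment X) (ε : ℝ) (n : ℕ) : Set G :=
  {g | g ∈ ball S (n:ℝ) ∧ ∃ h : ℕ → G,
    AlignedSeq (6 * E0 + 360 * δ)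
      ([GeodesicSegment.point x0] ++ transList ρ hisom Υ h ⌈ε * (n:ℝ)⌉₊ ++
        [GeodesicSegment.point (ρ g x0)]) ∧
    AlignedPair (6 * E0 + 360 * δ) (GeodesicSegment.point (ρ g⁻¹ x0))
      (Υ.translate (ρ (h 1)) (hisom _)) ∧
    AlignedPair (6 * E0 + 360 * δ) (Υ.translate (ρ (h ⌈ε * (n:ℝ)⌉₊)) (hisom _))
      (GeodesicSegment.point (ρ (g ^ 2) x0))}

/-- The set `BAD_{L,ε}(n)`. -/
def BADset (S : Finset G) (ρ : G → X → X) (hisom : ∀ g : G, Isometry (ρ g)) (x0 : X)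
    (δ E0 : ℝ) (Υ : GeodesicSegment X) (ε : ℝ) (n : ℕ) : Set G :=
  ball S (n:ℝ) \ (ball S ((⌊(0.9:ℝ) * (n:ℝ)⌋₊ : ℕ) : ℝ) ∪ Vset S ρ hisom x0 δ E0 Υ ε n)

/-! ### Paths in the word metric -/

/-- `P` is a `d_S`-path connecting `a` to `b`. -/
noncomputable def IsPathFrom (S : Finset G) (P : List G) (a b : G) : Prop :=
  P ≠ [] ∧ P.Chain' (fun u v => wordDist S u v = 1) ∧ P.head? = some a ∧ P.getLast? = some b

/-- The distance `d_S(P, g)` from a path `P` to a group element `g`. -/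
noncomputable def pathDist (S : Finset G) (P : List G) (g : G) : ℕ :=
  sInf {d | ∃ v ∈ P, d = wordDist S v g}

/-! ### Basic properties of geodesic segments -/

namespace GeodesicSegment

variable {X : Type*} [MetricSpace X]

theorem initial_mem (γ : GeodesicSegment X) : γ.initial ∈ γ.seg :=
  ⟨0, ⟨le_rfl, γ.len_nonneg⟩, rfl⟩

theorem terminal_mem (γ : GeodesicSegment X) : γ.terminal ∈ γ.seg :=
  ⟨γ.len, ⟨γ.len_nonneg, le_rfl⟩, rfl⟩

theorem continuousOn (γ : GeodesicSegment X) : ContinuousOn γ.toFun (Set.Icc 0 γ.len) := by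
  refine LipschitzOnWith.continuousOn (K := 1) (LipschitzOnWith.of_dist_le_mul ?_)
  intro s hs t ht
  rw [γ.isom s hs t ht, Real.dist_eq]
  simp

theorem isCompact_seg (γ : GeodesicSegment X) : IsCompact γ.seg :=
  isCompact_Icc.image_of_continuousOn γ.continuousOn

theorem isPreconnected_seg (γ : GeodesicSegment X) : IsPreconnected γ.seg :=
  isPreconnected_Icc.image _ γ.continuousOn

theorem dist_initial_terminal (γ : GeodesicSegment X) :
    dist γ.initial γ.terminal = γ.len := by
  have := γ.isom 0 ⟨le_rfl, γ.len_nonneg⟩ γ.len ⟨γ.len_nonneg, le_rfl⟩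
  rw [initial, terminal, this, zero_sub, abs_neg, abs_of_nonneg γ.len_nonneg]

theorem dist_initial_toFun (γ : GeodesicSegment X) {t : ℝ} (ht : t ∈ Set.Icc 0 γ.len) :
    dist (γ.toFun t) γ.initial = t := by
  rw [initial, γ.isom t ht 0 ⟨le_rfl, γ.len_nonneg⟩, sub_zero, abs_of_nonneg ht.1]

theorem dist_terminal_toFun (γ : GeodesicSegment X) {t : ℝ} (ht : t ∈ Set.Icc 0 γ.len) :
    dist (γ.toFun t) γ.terminal = γ.len - t := by
  rw [terminal, γ.isom t ht γ.len ⟨γ.len_nonneg, le_rfl⟩, abs_sub_comm,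
    abs_of_nonneg (sub_nonneg.2 ht.2)]

theorem dist_add_dist (γ : GeodesicSegment X) {p : X} (hp : p ∈ γ.seg) :
    dist γ.initial p + dist p γ.terminal = dist γ.initial γ.terminal := by
  obtain ⟨t, ht, rfl⟩ := hp
  rw [dist_comm γ.initial, γ.dist_initial_toFun ht, γ.dist_terminal_toFun ht,
    γ.dist_initial_terminal]
  ring

/-- A geodesic segment with the opposite orientation. -/
def reverse (γ : GeodesicSegment X) : GeodesicSegment X where
  len := γ.len
  len_nonneg := γ.len_nonneg
  toFun := fun t => γ.toFun (γ.len - t)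
  isom := fun s hs t ht => by
    rw [γ.isom _ ⟨by linarith [hs.2], by linarith [hs.1]⟩ _
      ⟨by linarith [ht.2], by linarith [ht.1]⟩, abs_sub_comm]
    congr 1
    ring

@[simp]
theorem reverse_initial (γ : GeodesicSegment X) : γ.reverse.initial = γ.terminal := by
  simp [reverse, initial, terminal]

@[simp]
theorem reverse_terminal (γ : GeodesicSegment X) : γ.reverse.terminal = γ.initial := by
  simp [reverse, initial, terminal]

@[simp]
theorem reverse_seg (γ : GeodesicSegment X) : γ.reverse.seg = γ.seg := by
  ext x
  constructor
  · rintro ⟨t, ht, rfl⟩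
    exact ⟨γ.len - t, ⟨sub_nonneg.2 ht.2, sub_le_self _ ht.1⟩, rfl⟩
  · rintro ⟨t, ht, rfl⟩
    exact ⟨γ.len - t, ⟨sub_nonneg.2 ht.2, sub_le_self _ ht.1⟩, by simp [reverse]⟩

theorem seg_translate (γ : GeodesicSegment X) (f : X → X) (hf : Isometry f) :
    (γ.translate f hf).seg = f '' γ.seg :=
  Set.image_comp f γ.toFun _

theorem mem_point_seg (p : X) : p ∈ (point p).seg := initial_mem (point p)

theorem translate_translate (γ : GeodesicSegment X) {f g k : X → X} (hf : Isometry f)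
    (hg : Isometry g) (hk : Isometry k) (h : ∀ x, k x = g (f x)) :
    γ.translate k hk = (γ.translate f hf).translate g hg := by
  obtain rfl : k = g ∘ f := funext h
  rfl

/-- Points of a segment at distance at most `R` from its terminal point are at distance at most
`R` from each other. -/
theorem dist_le_of_dist_terminal_le (γ : GeodesicSegment X) {R : ℝ} {p q : X}
    (hp : p ∈ γ.seg) (hq : q ∈ γ.seg) (hpR : dist p γ.terminal ≤ R)
    (hqR : dist q γ.terminal ≤ R) : dist p q ≤ R := by
  obtain ⟨s, hs, rfl⟩ := hp
  obtain ⟨t, ht, rfl⟩ := hq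
  rw [γ.dist_terminal_toFun hs] at hpR
  rw [γ.dist_terminal_toFun ht] at hqR
  rw [γ.isom s hs t ht, abs_le]
  constructor <;> linarith [hs.2, ht.2]

/-- The point at distance `r` from `p` on the way from `p` to `q`. -/
theorem exists_mem_dist_eq (γ : GeodesicSegment X) {p q : X} (hp : p ∈ γ.seg)
    (hq : q ∈ γ.seg) {r : ℝ} (hr : 0 ≤ r) (hrq : r ≤ dist p q) :
    ∃ c ∈ γ.seg, dist p c = r ∧ dist c q = dist p q - r := by
  obtain ⟨s, hs, rfl⟩ := hp
  obtain ⟨t, ht, rfl⟩ := hq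
  rw [γ.isom s hs t ht] at hrq ⊢
  rcases le_total s t with hst | hst
  · rw [abs_sub_comm, abs_of_nonneg (sub_nonneg.2 hst)] at hrq
    have hc : s + r ∈ Set.Icc 0 γ.len := ⟨by linarith [hs.1], by linarith [ht.2]⟩
    refine ⟨_, ⟨s + r, hc, rfl⟩, ?_, ?_⟩
    · rw [γ.isom s hs _ hc, sub_add_cancel_left, abs_neg, abs_of_nonneg hr]
    · rw [γ.isom _ hc t ht, abs_sub_comm, abs_of_nonneg (by linarith),
        abs_sub_comm, abs_of_nonneg (by linarith)]
      ring
  · rw [abs_of_nonneg (sub_nonneg.2 hst)] at hrq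
    have hc : s - r ∈ Set.Icc 0 γ.len := ⟨by linarith [ht.1], by linarith [hs.2]⟩
    refine ⟨_, ⟨s - r, hc, rfl⟩, ?_, ?_⟩
    · rw [γ.isom s hs _ hc, sub_sub_cancel, abs_of_nonneg hr]
    · rw [γ.isom _ hc t ht, abs_of_nonneg (by linarith), abs_of_nonneg (by linarith)]
      ring

/-- The Gromov product of two points near the terminal point of `γ`, based at a point of `γ`. -/
theorem le_excess_of_dist_terminal_le (γ : GeodesicSegment X) {b y z : X} {K : ℝ}
    (hb : b ∈ γ.seg) (hy : y ∈ γ.seg) (hz : z ∈ γ.seg)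
    (hyK : dist y γ.terminal ≤ K) (hzK : dist z γ.terminal ≤ K) :
    2 * (dist b γ.terminal - K) ≤ dist b y + dist b z - dist y z := by
  obtain ⟨r, hr, rfl⟩ := hb
  obtain ⟨s, hs, rfl⟩ := hy
  obtain ⟨t, ht, rfl⟩ := hz
  rw [γ.dist_terminal_toFun hs] at hyK
  rw [γ.dist_terminal_toFun ht] at hzK
  rw [γ.dist_terminal_toFun hr, γ.isom r hr s hs, γ.isom r hr t ht, γ.isom s hs t ht]
  rcases abs_cases (s - t) with ⟨h, -⟩ | ⟨h, -⟩ <;>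
    linarith [neg_le_abs (r - s), neg_le_abs (r - t)]

/-- If `p` and `q` are near the two endpoints of `γ` then every point of `γ` almost lies
between them. -/
theorem excess_le_of_dist_endpoints_le (γ : GeodesicSegment X) {b p q : X} {K : ℝ}
    (hb : b ∈ γ.seg) (hp : p ∈ γ.seg) (hq : q ∈ γ.seg) (hlen : 2 * K ≤ γ.len)
    (hpK : dist p γ.initial ≤ K) (hqK : dist q γ.terminal ≤ K) :
    dist p b + dist b q - dist p q ≤ 2 * K := by
  obtain ⟨r, hr, rfl⟩ := hb
  obtain ⟨s, hs, rfl⟩ := hp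
  obtain ⟨t, ht, rfl⟩ := hq
  rw [γ.dist_initial_toFun hs] at hpK
  rw [γ.dist_terminal_toFun ht] at hqK
  rw [γ.isom s hs r hr, γ.isom r hr t ht, γ.isom s hs t ht]
  obtain ⟨hr0, hr1⟩ := hr
  obtain ⟨hs0, hs1⟩ := hs
  obtain ⟨ht0, ht1⟩ := ht
  rcases abs_cases (s - r) with ⟨h, h'⟩ | ⟨h, h'⟩ <;>
  rcases abs_cases (r - t) with ⟨h2, h2'⟩ | ⟨h2, h2'⟩ <;>
    linarith [neg_le_abs (s - t)]

end GeodesicSegment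

/-! ### Projections and alignment -/

section Projection

variable {X : Type*} [MetricSpace X]

theorem proj_nonempty (γ : GeodesicSegment X) (x : X) : (proj γ x).Nonempty := by
  obtain ⟨p, hp, h⟩ := γ.isCompact_seg.exists_infDist_eq_dist ⟨_, γ.initial_mem⟩ x
  exact ⟨p, hp, h.symm⟩

theorem dist_le_of_mem_proj {γ : GeodesicSegment X} {x p q : X} (hp : p ∈ proj γ x)
    (hq : q ∈ γ.seg) : dist x p ≤ dist x q :=
  hp.2.trans_le (Metric.infDist_le_dist_of_mem hq)

@[simp]
theorem proj_reverse (γ : GeodesicSegment X) (x : X) : proj γ.reverse x = proj γ x := by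
  simp [proj]

@[simp]
theorem projSet_reverse (γ : GeodesicSegment X) (A : Set X) :
    projSet γ.reverse A = projSet γ A := by
  simp [projSet]

theorem proj_translate (γ : GeodesicSegment X) {f : X → X} (hf : Isometry f) (x : X) :
    proj (γ.translate f hf) (f x) = f '' proj γ x := by
  ext y
  simp only [proj, γ.seg_translate, Set.mem_ofPred_eq, Set.mem_image,
    Metric.infDist_image hf]
  constructor
  · rintro ⟨⟨p, hp, rfl⟩, h⟩
    exact ⟨p, ⟨hp, by rwa [hf.dist_eq] at h⟩, rfl⟩
  · rintro ⟨p, ⟨hp, h⟩, rfl⟩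
    exact ⟨⟨p, hp, rfl⟩, by rwa [hf.dist_eq]⟩

theorem projSet_translate (γ : GeodesicSegment X) {f : X → X} (hf : Isometry f) (A : Set X) :
    projSet (γ.translate f hf) (f '' A) = f '' projSet γ A := by
  simp only [projSet, Set.biUnion_image, proj_translate, Set.image_iUnion]

theorem projSet_subset_seg (γ : GeodesicSegment X) (A : Set X) : projSet γ A ⊆ γ.seg :=
  Set.iUnion₂_subset fun _ _ _ hp => hp.1

theorem AlignedPair.reverse {K : ℝ} {γ η : GeodesicSegment X} (h : AlignedPair K γ η) :
    AlignedPair K η.reverse γ.reverse := by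
  simpa [AlignedPair] using h.symm

theorem AlignedPair.mono {K K' : ℝ} (hK : K ≤ K') {γ η : GeodesicSegment X}
    (h : AlignedPair K γ η) : AlignedPair K' γ η :=
  ⟨h.1.trans_le hK, h.2.trans_le hK⟩

theorem AlignedPair.translate {K : ℝ} {γ η : GeodesicSegment X} (h : AlignedPair K γ η)
    {f : X → X} (hf : Isometry f) :
    AlignedPair K (γ.translate f hf) (η.translate f hf) := by
  have aux : ∀ (α : GeodesicSegment X) (A : Set X) (p : X),
      Metric.diam (projSet (α.translate f hf) (f '' A) ∪ {f p}) =
        Metric.diam (projSet α A ∪ {p}) := by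
    intro α A p
    rw [projSet_translate, ← Set.image_singleton, ← Set.image_union, hf.diam_image]
  unfold AlignedPair
  rw [γ.seg_translate, η.seg_translate]
  exact ⟨(aux γ η.seg γ.terminal).trans_lt h.1, (aux η γ.seg η.initial).trans_lt h.2⟩

theorem AlignedPair.dist_terminal_lt {K : ℝ} {γ η : GeodesicSegment X}
    (h : AlignedPair K γ η) {x p : X} (hx : x ∈ η.seg) (hp : p ∈ proj γ x) :
    dist p γ.terminal < K := by
  refine (Metric.dist_le_diam_of_mem (γ.isCompact_seg.isBounded.subset ?_) ?_ ?_).trans_lt h.1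
  · exact Set.union_subset (projSet_subset_seg γ _) (Set.singleton_subset_iff.2 γ.terminal_mem)
  · exact Or.inl (Set.mem_biUnion hx hp)
  · exact Or.inr rfl

theorem AlignedPair.dist_initial_lt {K : ℝ} {γ η : GeodesicSegment X}
    (h : AlignedPair K γ η) {x p : X} (hx : x ∈ γ.seg) (hp : p ∈ proj η x) :
    dist p η.initial < K := by
  rw [← η.reverse_terminal]
  exact h.reverse.dist_terminal_lt (by simpa using hx) (by simpa using hp)

theorem diam_projSet_union_terminal_le {γ : GeodesicSegment X} {A : Set X} {R : ℝ}
    (hR : 0 ≤ R) (h : ∀ x ∈ A, ∀ p ∈ proj γ x, dist p γ.terminal ≤ R) :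
    Metric.diam (projSet γ A ∪ {γ.terminal}) ≤ R := by
  have aux : ∀ p ∈ projSet γ A ∪ {γ.terminal}, p ∈ γ.seg ∧ dist p γ.terminal ≤ R := by
    rintro p (hp | rfl)
    · obtain ⟨x, hx, hpx⟩ := Set.mem_iUnion₂.1 hp
      exact ⟨hpx.1, h x hx p hpx⟩
    · exact ⟨γ.terminal_mem, by simpa using hR⟩
  refine Metric.diam_le_of_forall_dist_le hR fun p hp q hq => ?_
  exact γ.dist_le_of_dist_terminal_le (aux p hp).1 (aux q hq).1 (aux p hp).2 (aux q hq).2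

end Projection

/-! ### Consequences of hyperbolicity -/

section Hyperbolic

variable {X : Type*} [MetricSpace X] {δ : ℝ}

theorem exists_dist_le_of_mem_cthickening {γ : GeodesicSegment X} (hδ : 0 < δ) {p : X}
    (hp : p ∈ Metric.cthickening δ γ.seg) : ∃ q ∈ γ.seg, dist p q ≤ δ := by
  rw [γ.isCompact_seg.cthickening_eq_biUnion_closedBall hδ.le] at hp
  obtain ⟨q, hq, h⟩ := Set.mem_iUnion₂.1 hp
  exact ⟨q, hq, h⟩

/-- In a slim triangle, the distance to the opposite side is almost the Gromov product. -/
theorem IsDeltaHyperbolic.exists_dist_le (hhyp : IsDeltaHyperbolic X δ) (hδ : 0 < δ)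
    (hgeo : IsGeodesicSpace X) (γ : GeodesicSegment X) (x : X) :
    ∃ p ∈ γ.seg,
      2 * dist x p ≤ dist x γ.initial + dist x γ.terminal - dist γ.initial γ.terminal + 4 * δ := by
  obtain ⟨α, hα, hα'⟩ := hgeo γ.initial x
  obtain ⟨β, hβ, hβ'⟩ := hgeo x γ.terminal
  have hsub := hhyp α β γ hα (hα'.trans hβ.symm) hβ'
  rw [Metric.cthickening_union] at hsub
  obtain ⟨p, hp, hpα, hpβ⟩ := isPreconnected_closed_iff.1 γ.isPreconnected_seg _ _
    Metric.isClosed_cthickening Metric.isClosed_cthickening hsub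
    ⟨γ.initial, γ.initial_mem, Metric.self_subset_cthickening _ (hα ▸ α.initial_mem)⟩
    ⟨γ.terminal, γ.terminal_mem, Metric.self_subset_cthickening _ (hβ' ▸ β.terminal_mem)⟩
  obtain ⟨a, ha, hpa⟩ := exists_dist_le_of_mem_cthickening hδ hpα
  obtain ⟨b, hb, hpb⟩ := exists_dist_le_of_mem_cthickening hδ hpβ
  refine ⟨p, hp, ?_⟩
  have h1 := α.dist_add_dist ha
  have h2 := β.dist_add_dist hb
  have h3 := γ.dist_add_dist hp
  rw [hα, hα'] at h1
  rw [hβ, hβ'] at h2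
  linarith [dist_triangle x a p, dist_triangle x b p, dist_triangle γ.initial a p,
    dist_triangle p b γ.terminal, dist_comm a p, dist_comm b p, dist_comm a x,
    dist_comm γ.initial x]

/-- Slim triangles imply the four-point inequality. -/
theorem IsDeltaHyperbolic.four_point (hhyp : IsDeltaHyperbolic X δ) (hδ : 0 < δ)
    (hgeo : IsGeodesicSpace X) (w x y z : X) :
    dist w x + dist y z ≤ dist w z + dist x y + 6 * δ ∨
      dist w x + dist y z ≤ dist w y + dist x z + 6 * δ := by
  obtain ⟨γ, rfl, rfl⟩ := hgeo y z
  obtain ⟨α, hα, hα'⟩ := hgeo γ.initial x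
  obtain ⟨β, hβ, hβ'⟩ := hgeo x γ.terminal
  obtain ⟨p, hp, hwp⟩ := hhyp.exists_dist_le hδ hgeo γ w
  have hsub := hhyp α β γ hα (hα'.trans hβ.symm) hβ' hp
  rw [Metric.cthickening_union] at hsub
  rcases hsub with h | h
  · obtain ⟨n, hn, hpn⟩ := exists_dist_le_of_mem_cthickening hδ h
    have h1 := α.dist_add_dist hn
    rw [hα, hα'] at h1
    left
    linarith [dist_triangle w n γ.initial, dist_triangle w n x, dist_triangle w p n,
      dist_comm n γ.initial, dist_comm x γ.initial]
  · obtain ⟨n, hn, hpn⟩ := exists_dist_le_of_mem_cthickening hδ h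
    have h1 := β.dist_add_dist hn
    rw [hβ, hβ'] at h1
    right
    linarith [dist_triangle w n γ.terminal, dist_triangle w n x, dist_triangle w p n,
      dist_comm n x]

/-- A path through the closest point projection is almost geodesic. -/
theorem IsDeltaHyperbolic.dist_proj_add_le (hhyp : IsDeltaHyperbolic X δ) (hδ : 0 < δ)
    (hgeo : IsGeodesicSpace X) {γ : GeodesicSegment X} {x p q : X} (hp : p ∈ proj γ x)
    (hq : q ∈ γ.seg) : dist x p + dist p q ≤ dist x q + 13 * δ := by
  have hxq := dist_le_of_mem_proj hp hq
  rcases le_total (dist p q) (7 * δ) with h | h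
  · linarith
  · obtain ⟨c, hc, hpc, hcq⟩ := γ.exists_mem_dist_eq hp.1 hq (by positivity) h
    have hxc := dist_le_of_mem_proj hp hc
    rcases hhyp.four_point hδ hgeo x c p q with h' | h' <;>
      linarith [dist_comm p c]

/-- If two points have distant projections to a segment, then the path through the two
projections is almost geodesic. -/
theorem IsDeltaHyperbolic.dist_proj_proj_add_le (hhyp : IsDeltaHyperbolic X δ) (hδ : 0 < δ)
    (hgeo : IsGeodesicSpace X) {γ : GeodesicSegment X} {x y p q : X} (hp : p ∈ proj γ x)
    (hq : q ∈ proj γ y) (hpq : 16 * δ < dist p q) :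
    dist x p + dist p q + dist q y ≤ dist x y + 32 * δ := by
  have h1 := hhyp.dist_proj_add_le hδ hgeo hp hq.1
  have h2 := hhyp.dist_proj_add_le hδ hgeo hq hp.1
  rcases hhyp.four_point hδ hgeo x q p y with h | h <;>
    linarith [dist_comm p q, dist_comm y q, dist_comm y p]

/-- Suppose `y` and `z` project to `γ` near its terminal point and to `η` near the initial and
the terminal point, respectively. Then `η` projects to `γ` near its terminal point. -/
theorem IsDeltaHyperbolic.dist_terminal_le (hhyp : IsDeltaHyperbolic X δ) (hδ : 0 < δ)
    (hgeo : IsGeodesicSpace X) {γ η : GeodesicSegment X} {y z : X} {K K' : ℝ} (hK : 0 ≤ K)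
    (hKK' : K ≤ K') (hlen : 2 * K' + 16 * δ < η.len)
    (hyγ : ∀ p ∈ proj γ y, dist p γ.terminal ≤ K) (hzγ : ∀ p ∈ proj γ z, dist p γ.terminal ≤ K)
    (hyη : ∀ p ∈ proj η y, dist p η.initial ≤ K) (hzη : ∀ p ∈ proj η z, dist p η.terminal ≤ K')
    {b p : X} (hb : b ∈ η.seg) (hp : p ∈ proj γ b) :
    dist p γ.terminal ≤ K + K' + 48 * δ := by
  by_contra! hcon
  obtain ⟨y₁, hy₁⟩ := proj_nonempty γ y
  obtain ⟨z₁, hz₁⟩ := proj_nonempty γ z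
  obtain ⟨y₂, hy₂⟩ := proj_nonempty η y
  obtain ⟨z₂, hz₂⟩ := proj_nonempty η z
  have hy₁K := hyγ y₁ hy₁
  have hz₁K := hzγ z₁ hz₁
  have hy₂K := hyη y₂ hy₂
  have hz₂K := hzη z₂ hz₂
  have hfar : 16 * δ < dist y₂ z₂ := by
    linarith [η.dist_initial_terminal, dist_triangle4 η.initial y₂ z₂ η.terminal,
      dist_comm η.initial y₂]
  have h1 := hhyp.dist_proj_proj_add_le hδ hgeo hy₂ hz₂ hfar
  have h2 := η.excess_le_of_dist_endpoints_le (K := K') hb hy₂.1 hz₂.1 (by linarith)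
    (hy₂K.trans hKK') hz₂K
  have h3 := hhyp.dist_proj_proj_add_le hδ hgeo hp hy₁
    (by linarith [dist_triangle p y₁ γ.terminal])
  have h4 := hhyp.dist_proj_proj_add_le hδ hgeo hp hz₁
    (by linarith [dist_triangle p z₁ γ.terminal])
  have h5 := γ.le_excess_of_dist_terminal_le hp.1 hy₁.1 hz₁.1 hy₁K hz₁K
  linarith [dist_triangle4 y y₁ z₁ z, dist_triangle b y₂ y, dist_triangle b z₂ z,
    dist_comm b y₂, dist_comm y y₂, dist_comm y y₁, dist_comm z z₂, dist_nonneg (x := b) (y := p)]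

/-- A point projecting near the initial point of a long segment also projects near the initial
point of the next segment in an aligned pair. -/
theorem IsDeltaHyperbolic.dist_initial_le_of_alignedPair (hhyp : IsDeltaHyperbolic X δ)
    (hδ : 0 < δ) (hgeo : IsGeodesicSpace X) {γ η : GeodesicSegment X} {x : X} {K : ℝ}
    (h : AlignedPair K γ η) (hlen : 2 * K + 61 * δ ≤ γ.len)
    (hx : ∀ p ∈ proj γ x, dist p γ.initial ≤ K + 45 * δ) {q : X} (hq : q ∈ proj η x) :
    dist q η.initial ≤ K + 45 * δ := by
  obtain ⟨p, hp⟩ := proj_nonempty γ x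
  obtain ⟨s, hs⟩ := proj_nonempty γ q
  obtain ⟨t, ht⟩ := proj_nonempty η s
  have hpK := hx p hp
  have hsK := h.dist_terminal_lt hq.1 hs
  have htK := h.dist_initial_lt hs.1 ht
  have h1 := hhyp.dist_proj_proj_add_le hδ hgeo hp hs
    (by linarith [γ.dist_initial_terminal, dist_triangle4 γ.initial p s γ.terminal,
      dist_comm γ.initial p])
  have h2 := hhyp.dist_proj_add_le hδ hgeo ht hq.1
  have h3 := dist_le_of_mem_proj hq ht.1
  linarith [dist_triangle4 x p s t, dist_triangle q t η.initial, dist_comm q t]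

/-- In an aligned sequence of long segments starting at a point `x`, the point `x` projects to
every segment near its initial point. -/
theorem IsDeltaHyperbolic.dist_initial_le_of_aligned (hhyp : IsDeltaHyperbolic X δ)
    (hδ : 0 < δ) (hgeo : IsGeodesicSpace X) {γ : ℕ → GeodesicSegment X} {x : X} {K : ℝ} (n : ℕ)
    (hx : ∀ p ∈ proj (γ 0) x, dist p (γ 0).initial ≤ K)
    (h : ∀ i < n, AlignedPair K (γ i) (γ (i + 1)))
    (hlen : ∀ i < n, 2 * K + 61 * δ ≤ (γ i).len) {q : X} (hq : q ∈ proj (γ n) x) :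
    dist q (γ n).initial ≤ K + 45 * δ := by
  induction n generalizing q with
  | zero => linarith [hx q hq]
  | succ n ih =>
    exact hhyp.dist_initial_le_of_alignedPair hδ hgeo (h n n.lt_succ_self)
      (hlen n n.lt_succ_self)
      (fun p hp => ih (fun i hi => h i (hi.trans n.lt_succ_self))
        (fun i hi => hlen i (hi.trans n.lt_succ_self)) hp) hq

/-- Two long segments `γ` and `η` are aligned if there are three points `x`, `y`, `z` with
`x` projecting near both initial points, `z` near both terminal points, and `y` near the terminal
point of `γ` and the initial point of `η`. -/
theorem IsDeltaHyperbolic.alignedPair_of_three_points (hhyp : IsDeltaHyperbolic X δ)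
    (hδ : 0 < δ) (hgeo : IsGeodesicSpace X) {γ η : GeodesicSegment X} {x y z : X} {K K' C : ℝ}
    (hK : 0 ≤ K) (hKK' : K ≤ K') (hC : K + K' + 48 * δ < C)
    (hγlen : 2 * K' + 16 * δ < γ.len) (hηlen : 2 * K' + 16 * δ < η.len)
    (hxγ : ∀ p ∈ proj γ x, dist p γ.initial ≤ K') (hxη : ∀ p ∈ proj η x, dist p η.initial ≤ K)
    (hyγ : ∀ p ∈ proj γ y, dist p γ.terminal ≤ K) (hyη : ∀ p ∈ proj η y, dist p η.initial ≤ K)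
    (hzγ : ∀ p ∈ proj γ z, dist p γ.terminal ≤ K)
    (hzη : ∀ p ∈ proj η z, dist p η.terminal ≤ K') : AlignedPair C γ η := by
  have hR : 0 ≤ K + K' + 48 * δ := by linarith
  constructor
  · exact (diam_projSet_union_terminal_le hR fun b hb p hp =>
      hhyp.dist_terminal_le hδ hgeo hK hKK' hηlen hyγ hzγ hyη hzη hb hp).trans_lt hC
  · have := diam_projSet_union_terminal_le (γ := η.reverse) (A := γ.seg) hR fun b hb p hp =>
      hhyp.dist_terminal_le (η := γ.reverse) (y := y) (z := x) hδ hgeo hK hKK' hγlen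
        (by simpa using hyη) (by simpa using hxη) (by simpa using hyγ) (by simpa using hxγ)
        (by simpa using hb) hp
    simp only [projSet_reverse, GeodesicSegment.reverse_terminal] at this
    exact this.trans_lt hC

end Hyperbolic

section Action

variable {G : Type*} {X : Type*} [MetricSpace X]

theorem IsLoxodromic.exists_lt_dist [Group G] {ρ : G → X → X} {x0 : X} {φ : G}
    (h : IsLoxodromic ρ x0 φ) (T : ℝ) :
    ∃ L1 : ℝ, 0 < L1 ∧ ∀ L : ℕ, L1 < (L : ℝ) → T < dist x0 (ρ (φ ^ L) x0) := by
  obtain ⟨τ, hτ, hlim⟩ := h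
  obtain ⟨N, hN⟩ := Filter.eventually_atTop.1
    (hlim.eventually (lt_mem_nhds (half_lt_self hτ)))
  refine ⟨max (max N (2 * T / τ)) 1, by positivity, fun L hL => ?_⟩
  simp only [max_lt_iff] at hL
  obtain ⟨⟨hL1, hL2⟩, hL3⟩ := hL
  have h1 := hN L (by exact_mod_cast hL1.le)
  rw [lt_div_iff₀ (by linarith)] at h1
  rw [div_lt_iff₀ hτ] at hL2
  linarith

/-- Unpacking of alignment for a sequence of translates between two points. -/
theorem AlignedSeq.transList_pairs {ρ : G → X → X} {hisom : ∀ g : G, Isometry (ρ g)}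
    {Υ : GeodesicSegment X} {h : ℕ → G} {m : ℕ} (hm : 1 ≤ m) {K : ℝ}
    {α β : GeodesicSegment X} (H : AlignedSeq K ([α] ++ transList ρ hisom Υ h m ++ [β])) :
    AlignedPair K α (Υ.translate (ρ (h 1)) (hisom _)) ∧
      (∀ i : ℕ, 1 ≤ i → i < m → AlignedPair K (Υ.translate (ρ (h i)) (hisom _))
        (Υ.translate (ρ (h (i + 1))) (hisom _))) ∧
      AlignedPair K (Υ.translate (ρ (h m)) (hisom _)) β := by
  have H' := List.isChain_iff_getElem.1 H
  have hlen : (transList ρ hisom Υ h m).length = m := by simp [transList]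
  refine ⟨?_, fun i hi him => ?_, ?_⟩
  · have := H' 0 (by simp [hlen])
    simpa [transList, List.getElem_append, List.getElem_cons, show 0 < m by omega] using this
  · obtain ⟨k, rfl⟩ := Nat.exists_eq_add_of_le' hi
    have := H' (k + 1) (by simp [hlen]; omega)
    simpa [transList, List.getElem_append, List.getElem_cons, him, show k < m by omega] using this
  · obtain ⟨k, rfl⟩ := Nat.exists_eq_add_of_le' hm
    have := H' (k + 1) (by simp [hlen])
    simpa [transList, List.getElem_append, List.getElem_cons] using this

end Action

/-- The bi-infinite sequence `(g^j h_i Υ_L)_{(j,i) ∈ ℤ × {1,…,m}}` (lexicographic order)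
is `(12E₀+900δ)`-aligned (first claim in the proof of Lemma 4.4). -/
theorem biinfinite_aligned {G : Type*} [Group G] {X : Type*} [MetricSpace X]
    (S : Finset G) (hSgen : Subgroup.closure (S : Set G) = ⊤)
    (hNVC : NonVirtuallyCyclic G)
    (δ : ℝ) (hδ : 0 < δ) (hgeo : IsGeodesicSpace X) (hhyp : IsDeltaHyperbolic X δ)
    (ρ : G → X → X) (hisom : ∀ g : G, Isometry (ρ g))
    (hmul : ∀ g h : G, ∀ x : X, ρ (g * h) x = ρ g (ρ h x)) (hone : ∀ x : X, ρ 1 x = x)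
    (x0 : X) (φ : G)
    (hlox : IsLoxodromic ρ x0 φ) (hwpd : HasWPD ρ x0 φ)
    (E0 : ℝ) (hE0 : E0Spec S ρ x0 φ E0) :
    ∃ L1 : ℝ, 0 < L1 ∧ ∀ L : ℕ, L1 < (L : ℝ) →
      ∀ Υ : GeodesicSegment X, Υ.initial = x0 → Υ.terminal = ρ (φ ^ L) x0 →
      ∀ (g : G) (m : ℕ) (h : ℕ → G), 1 ≤ m →
        AlignedSeq (6 * E0 + 360 * δ)
          ([GeodesicSegment.point x0] ++ transList ρ hisom Υ h m ++
            [GeodesicSegment.point (ρ g x0)]) →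
        AlignedPair (6 * E0 + 360 * δ) (GeodesicSegment.point (ρ g⁻¹ x0))
          (Υ.translate (ρ (h 1)) (hisom _)) →
        AlignedPair (6 * E0 + 360 * δ) (Υ.translate (ρ (h m)) (hisom _))
          (GeodesicSegment.point (ρ (g ^ 2) x0)) →
        ∀ j : ℤ,
          (∀ i : ℕ, 1 ≤ i → i < m →
            AlignedPair (12 * E0 + 900 * δ)
              (Υ.translate (ρ (g ^ j * h i)) (hisom _))
              (Υ.translate (ρ (g ^ j * h (i + 1))) (hisom _))) ∧
          AlignedPair (12 * E0 + 900 * δ)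
            (Υ.translate (ρ (g ^ j * h m)) (hisom _))
            (Υ.translate (ρ (g ^ (j + 1) * h 1)) (hisom _)) := by
  have hE0pos := hE0.1
  set K := 6 * E0 + 360 * δ with hKdef
  have hK0 : 0 < K := by positivity
  obtain ⟨L1, hL1, hlong⟩ := hlox.exists_lt_dist (2 * K + 200 * δ)
  refine ⟨L1, hL1, fun L hL Υ hΥi hΥt g m h hm hseq hfirst hlast j => ?_⟩
  have hlen : 2 * K + 200 * δ < Υ.len := by
    rw [← Υ.dist_initial_terminal, hΥi, hΥt]
    exact hlong L hL
  obtain ⟨hstart, hmid, hend⟩ := hseq.transList_pairs hm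
  set T : G → GeodesicSegment X := fun k => Υ.translate (ρ k) (hisom k)
  have htrans : ∀ a b : G, T (a * b) = (T b).translate (ρ a) (hisom a) := fun a b =>
    Υ.translate_translate _ _ _ (hmul a b)
  refine ⟨fun i hi him => ?_, ?_⟩
  · change AlignedPair _ (T (g ^ j * h i)) (T (g ^ j * h (i + 1)))
    rw [htrans, htrans]
    exact ((hmid i hi him).translate _).mono (by linarith)
  change AlignedPair _ (T (g ^ j * h m)) (T (g ^ (j + 1) * h 1))
  rw [zpow_add_one, mul_assoc, htrans, htrans (g ^ j) (g * h 1)]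
  refine AlignedPair.translate ?_ _
  have hx : ∀ p ∈ proj (T (h m)) x0, dist p (T (h m)).initial ≤ K + 45 * δ := by
    intro p hp
    obtain ⟨n, rfl⟩ := Nat.exists_eq_add_of_le' hm
    refine hhyp.dist_initial_le_of_aligned hδ hgeo (γ := fun i => T (h (i + 1))) n
      (fun q hq => (hstart.dist_initial_lt (GeodesicSegment.mem_point_seg x0) hq).le)
      (fun i hi => hmid (i + 1) (by omega) (by omega)) (fun i _ => ?_) hp
    change _ ≤ Υ.len
    linarith
  have hz : ∀ p ∈ proj (T (h 1)) (ρ g x0), dist p (T (h 1)).terminal ≤ K + 45 * δ := by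
    intro p hp
    obtain ⟨n, rfl⟩ := Nat.exists_eq_add_of_le' hm
    have key := hhyp.dist_initial_le_of_aligned hδ hgeo
      (γ := fun i => (T (h (n + 1 - i))).reverse) (x := ρ g x0) (K := K) (q := p) n
      (fun q hq => ?_) (fun i hi => ?_) (fun i _ => ?_) ?_
    · simpa using key
    · rw [GeodesicSegment.reverse_initial]
      exact (hend.dist_terminal_lt (GeodesicSegment.mem_point_seg _) (by simpa using hq)).le
    · have := (hmid (n + 1 - (i + 1)) (by omega) (by omega)).reverse
      rwa [show n + 1 - (i + 1) + 1 = n + 1 - i by omega] at this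
    · change _ ≤ Υ.len
      linarith
    · simpa using hp
  have hpush : ∀ {x p : X}, p ∈ proj (T (g * h 1)) (ρ g x) →
      ∃ q ∈ proj (T (h 1)) x, p = ρ g q := by
    intro x p hp
    rw [htrans, proj_translate] at hp
    obtain ⟨q, hq, rfl⟩ := hp
    exact ⟨q, hq, rfl⟩
  have hinit : (T (g * h 1)).initial = ρ g (T (h 1)).initial := hmul _ _ _
  have hterm : (T (g * h 1)).terminal = ρ g (T (h 1)).terminal := hmul _ _ _
  have hx0 : ρ g (ρ g⁻¹ x0) = x0 := by rw [← hmul, mul_inv_cancel, hone]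
  have hg2 : ρ g (ρ g x0) = ρ (g ^ 2) x0 := by rw [← hmul, sq]
  refine hhyp.alignedPair_of_three_points hδ hgeo (K := K) (K' := K + 45 * δ) (x := x0)
    (y := ρ g x0) (z := ρ (g ^ 2) x0) hK0.le (by linarith) (by linarith)
    (show _ < Υ.len by linarith) (show _ < Υ.len by linarith) hx ?_ ?_ ?_ ?_ ?_
  · intro p hp
    rw [← hx0] at hp
    obtain ⟨q, hq, rfl⟩ := hpush hp
    rw [hinit, (hisom g).dist_eq]
    exact (hfirst.dist_initial_lt (GeodesicSegment.mem_point_seg _) hq).le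
  · exact fun p hp => (hend.dist_terminal_lt (GeodesicSegment.mem_point_seg _) hp).le
  · intro p hp
    obtain ⟨q, hq, rfl⟩ := hpush hp
    rw [hinit, (hisom g).dist_eq]
    exact (hstart.dist_initial_lt (GeodesicSegment.mem_point_seg _) hq).le
  · exact fun p hp => (hlast.dist_terminal_lt (GeodesicSegment.mem_point_seg _) hp).le
  · intro p hp
    rw [← hg2] at hp
    obtain ⟨q, hq, rfl⟩ := hpush hp
    rw [hterm, (hisom g).dist_eq]
    exact hz q hq

end AcylCount
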